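/- arXiv:2011.07683 — 2 statements merged into one kernel-verified Lean document; each statement's English description precedes it below -/
import Mathlib

section
/- Let ℒ be the Laplacian tensor of a weighted k-uniform hypergraph on Fin n. Let L_c : Matrix (Fin n) (Fin n) ℝ be the Laplacian of the clique expansion, defined by L_c i j = −Σ_{e ∈ E with i ∈ e and j ∈ e} w e for i ≠ j, and L_c i i = (k−1)·d i. Then L_c = (k−1)·M, where M i j = Σ over tuples (i₃,…,i_k) ∈ (Fin n)^{k−2} of ℒ(i,j,i₃,…,i_k) is the (k−2)-fold contraction of ℒ against the all-ones vector. -/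
open Finset

/-- Degree of vertex `i` in a weighted hypergraph `(E, w)`. -/
noncomputable def deg {n : ℕ} (E : Finset (Finset (Fin n))) (w : Finset (Fin n) → ℝ)
    (i : Fin n) : ℝ :=
  ∑ e ∈ E.filter (fun e => i ∈ e), w e

/-- Adjacency tensor of a weighted `k`-uniform hypergraph. -/
noncomputable def adjT {n : ℕ} (E : Finset (Finset (Fin n))) (w : Finset (Fin n) → ℝ)
    (k : ℕ) (σ : Fin k → Fin n) : ℝ :=
  if Function.Injective σ ∧ Finset.image σ Finset.univ ∈ E then
    w (Finset.image σ Finset.univ) / (Nat.factorial (k - 1)) else 0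

/-- Laplacian tensor `𝒟 - 𝒜`. -/
noncomputable def lapT {n : ℕ} (E : Finset (Finset (Fin n))) (w : Finset (Fin n) → ℝ)
    (k : ℕ) (σ : Fin k → Fin n) : ℝ :=
  (∑ i : Fin n, if σ = Function.const (Fin k) i then deg E w i else 0) - adjT E w k σ

/-- The tuple `(i, τ₁, …, τ_{k-1})`. -/
def consT {n : ℕ} (k : ℕ) (i : Fin n) (τ : Fin (k - 1) → Fin n) : Fin k → Fin n :=
  fun t => if ht : t.val = 0 then i else τ ⟨t.val - 1, by have := t.isLt; omega⟩

/-- The Laplacian form `ℒ x^k`. -/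
noncomputable def lapForm {n : ℕ} (E : Finset (Finset (Fin n))) (w : Finset (Fin n) → ℝ)
    (k : ℕ) (x : Fin n → ℝ) : ℝ :=
  ∑ σ : Fin k → Fin n, lapT E w k σ * ∏ t, x (σ t)

/-- The tuple `(i, j, τ₁, …, τ_{k-2})`. -/
def cons2T {n : ℕ} (k : ℕ) (i j : Fin n) (τ : Fin (k - 2) → Fin n) : Fin k → Fin n :=
  fun t =>
    if ht0 : t.val = 0 then i
    else if ht1 : t.val = 1 then j
    else τ ⟨t.val - 2, by have := t.isLt; omega⟩

theorem card_filter_injective_image_eq {α : Type*} [Fintype α] [DecidableEq α] {m : ℕ}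
    (s : Finset α) (hs : s.card = m) :
    (univ.filter fun τ : Fin m → α => Function.Injective τ ∧ univ.image τ = s).card =
      Nat.factorial m := by
  have hcard : Fintype.card (Fin m ≃ s) = Nat.factorial m := by
    rw [Fintype.card_equiv (Fintype.equivOfCardEq (by simp [hs])), Fintype.card_fin]
  rw [← hcard, ← Finset.card_univ]
  symm
  refine Finset.card_bij (fun f _ t => (f t : α)) ?_ ?_ ?_
  · intro f _
    simp only [mem_filter, mem_univ, true_and]
    refine ⟨Subtype.val_injective.comp f.injective, ?_⟩
    ext x
    simp only [mem_image, mem_univ, true_and]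
    constructor
    · rintro ⟨t, rfl⟩
      exact (f t).2
    · intro hx
      exact ⟨f.symm ⟨x, hx⟩, by simp⟩
  · intro f _ g _ h
    ext t
    exact congrFun h t
  · intro τ hτ
    simp only [mem_filter, mem_univ, true_and] at hτ
    obtain ⟨hinj, rfl⟩ := hτ
    refine ⟨Equiv.ofBijective (fun t => ⟨τ t, mem_image_of_mem τ (mem_univ t)⟩) ⟨?_, ?_⟩,
      mem_univ _, rfl⟩
    · intro a b h
      exact hinj (congrArg Subtype.val h)
    · rintro ⟨x, hx⟩
      obtain ⟨t, -, rfl⟩ := mem_image.mp hx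
      exact ⟨t, rfl⟩

theorem cons2T_eq_cons {n m : ℕ} (i j : Fin n) (τ : Fin m → Fin n) :
    cons2T (m + 2) i j τ = (Fin.cons i (Fin.cons j τ : Fin (m + 1) → Fin n)) := by
  funext t
  refine Fin.cases ?_ (fun t => ?_) t
  · simp [cons2T]
  · refine Fin.cases ?_ (fun t => ?_) t
    · simp [cons2T]
    · simp [cons2T]

theorem cons2T_injective_and_image_eq_iff {n m : ℕ} {i j : Fin n} (hij : i ≠ j)
    {e : Finset (Fin n)} (hi : i ∈ e) (hj : j ∈ e) (τ : Fin m → Fin n) :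
    (Function.Injective (cons2T (m + 2) i j τ) ∧ univ.image (cons2T (m + 2) i j τ) = e) ↔
      Function.Injective τ ∧ univ.image τ = (e.erase i).erase j := by
  have himage : univ.image (cons2T (m + 2) i j τ) = insert i (insert j (univ.image τ)) := by
    ext x
    simp [cons2T_eq_cons, Fin.exists_fin_succ, eq_comm]
  rw [himage, cons2T_eq_cons, Fin.cons_injective_iff, Fin.cons_injective_iff]
  have hi' : i ∉ Set.range (Fin.cons j τ : Fin (m + 1) → Fin n) ↔ i ∉ univ.image τ := by
    simp [hij]
  have hj' : j ∉ Set.range τ ↔ j ∉ univ.image τ := by simp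
  rw [hi', hj']
  constructor
  · rintro ⟨⟨h1, h2, h3⟩, rfl⟩
    refine ⟨h3, ?_⟩
    rw [erase_insert (by simp only [mem_insert, not_or]; exact ⟨hij, h1⟩), erase_insert h2]
  · rintro ⟨h3, h⟩
    rw [h]
    refine ⟨⟨by simp, by simp, h3⟩, ?_⟩
    rw [insert_erase (mem_erase.mpr ⟨hij.symm, hj⟩), insert_erase hi]

theorem adjT_cons2T_self {n m : ℕ} (E : Finset (Finset (Fin n))) (w : Finset (Fin n) → ℝ)
    (i : Fin n) (τ : Fin m → Fin n) : adjT E w (m + 2) (cons2T (m + 2) i i τ) = 0 := by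
  refine if_neg fun h => ?_
  have := @h.1 0 1 (by simp [cons2T])
  simp at this

theorem cons2T_eq_const_iff {n m : ℕ} (i j l : Fin n) (τ : Fin m → Fin n) :
    cons2T (m + 2) i j τ = Function.const (Fin (m + 2)) l ↔
      i = l ∧ j = l ∧ τ = Function.const (Fin m) l := by
  rw [cons2T_eq_cons]
  simp [funext_iff, Fin.forall_fin_succ]

theorem sum_adjT_cons2T {n m : ℕ} (E : Finset (Finset (Fin n))) (w : Finset (Fin n) → ℝ)
    (hcard : ∀ e ∈ E, e.card = m + 2) {i j : Fin n} (hij : i ≠ j) :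
    ((m : ℝ) + 1) * ∑ τ : Fin m → Fin n, adjT E w (m + 2) (cons2T (m + 2) i j τ) =
      ∑ e ∈ E.filter (fun e => i ∈ e ∧ j ∈ e), w e := by
  have hsplit : ∀ τ : Fin m → Fin n, adjT E w (m + 2) (cons2T (m + 2) i j τ) =
      ∑ e ∈ E.filter (fun e => i ∈ e ∧ j ∈ e),
        if Function.Injective τ ∧ univ.image τ = (e.erase i).erase j then
          w e / (Nat.factorial (m + 1)) else 0 := by
    intro τ
    have hi : i ∈ univ.image (cons2T (m + 2) i j τ) :=
      mem_image.mpr ⟨0, mem_univ _, by simp [cons2T]⟩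
    have hj : j ∈ univ.image (cons2T (m + 2) i j τ) :=
      mem_image.mpr ⟨1, mem_univ _, by simp [cons2T]⟩
    have hiff : ∀ e ∈ E.filter (fun e => i ∈ e ∧ j ∈ e),
        (if Function.Injective τ ∧ univ.image τ = (e.erase i).erase j then
          w e / (Nat.factorial (m + 1) : ℝ) else 0) =
        if univ.image (cons2T (m + 2) i j τ) = e then
          (if Function.Injective (cons2T (m + 2) i j τ) then
            w e / (Nat.factorial (m + 1) : ℝ) else 0) else 0 := by
      intro e he
      obtain ⟨-, hie, hje⟩ := mem_filter.mp he
      rw [← ite_and]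
      exact if_congr ((cons2T_injective_and_image_eq_iff hij hie hje τ).symm.trans and_comm) rfl rfl
    rw [sum_congr rfl hiff, sum_ite_eq]
    simp only [mem_filter, hi, hj, and_true]
    rw [← ite_and]
    exact if_congr and_comm rfl rfl
  simp_rw [hsplit]
  rw [sum_comm, mul_sum]
  refine sum_congr rfl fun e he => ?_
  obtain ⟨heE, hie, hje⟩ := mem_filter.mp he
  have hc : ((e.erase i).erase j).card = m := by
    rw [card_erase_of_mem (mem_erase.mpr ⟨hij.symm, hje⟩), card_erase_of_mem hie, hcard e heE]
    rfl
  rw [← sum_filter, sum_const, card_filter_injective_image_eq _ hc, nsmul_eq_mul,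
    Nat.factorial_succ]
  have := Nat.factorial_ne_zero m
  push_cast
  field_simp

/-- the Laplacian of the clique expansion equals `(k-1)` times the `(k-2)`-fold
contraction of the hypergraph Laplacian tensor against the all-ones vector. -/
theorem clique_laplacian_eq_contraction
    (n k : ℕ) (hn : 1 ≤ n) (hk : 2 ≤ k)
    (E : Finset (Finset (Fin n))) (w : Finset (Fin n) → ℝ)
    (hcard : ∀ e ∈ E, e.card = k) (hw : ∀ e ∈ E, 0 < w e)
    (Lc : Matrix (Fin n) (Fin n) ℝ)
    (hLc : ∀ i j, Lc i j =
      if i = j then ((k : ℝ) - 1) * deg E w i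
      else -(∑ e ∈ E.filter (fun e => i ∈ e ∧ j ∈ e), w e)) :
    ∀ i j, Lc i j = ((k : ℝ) - 1) * ∑ τ : Fin (k - 2) → Fin n, lapT E w k (cons2T k i j τ) := by
  obtain ⟨m, rfl⟩ : ∃ m, k = m + 2 := ⟨k - 2, by omega⟩
  intro i j
  change _ = _ * ∑ τ : Fin m → Fin n, _
  have hk1 : ((m + 2 : ℕ) : ℝ) - 1 = (m : ℝ) + 1 := by push_cast; ring
  rw [hLc, hk1]
  simp only [lapT, sum_sub_distrib, cons2T_eq_const_iff]
  split_ifs with hij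
  · subst hij
    congr 1
    simp only [adjT_cons2T_self, sum_const_zero, sub_zero]
    rw [sum_comm]
    simp [ite_and]
  · rw [mul_sub, sum_adjT_cons2T E w hcard hij]
    have hzero : ∀ (τ : Fin m → Fin n) (l : Fin n),
        (if i = l ∧ j = l ∧ τ = Function.const (Fin m) l then deg E w l else 0) = 0 :=
      fun τ l => if_neg fun h => hij (h.1.trans h.2.1.symm)
    simp [hzero]
end

section
/- Let 𝓛 be the normalized Laplacian tensor of a weighted k-uniform hypergraph on Fin n in which every vertex has positive degree, and define x : Fin n → ℝ by x i = (d i)^{1/k} (real power). Then 𝓛 x^{k−1} = 0, i.e., for every vertex i, the sum over all tuples τ : Fin (k−1) → Fin n of 𝓛(i,τ)·∏_t x(τ t) equals 0; in particular 𝓛 x^k = 0, so 0 is a Z-eigenvalue of the normalized Laplacian with eigenvector x/‖x‖. -/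
open Finset

/-- Normalized Laplacian tensor of a weighted `k`-uniform hypergraph. -/
noncomputable def normLapT {n : ℕ} (E : Finset (Finset (Fin n))) (w : Finset (Fin n) → ℝ)
    (k : ℕ) (σ : Fin k → Fin n) : ℝ :=
  if ∃ i, σ = Function.const (Fin k) i then 1
  else if Function.Injective σ ∧ Finset.image σ Finset.univ ∈ E then
    -(w (Finset.image σ Finset.univ) / (Nat.factorial (k - 1))) *
      ∏ t, (deg E w (σ t)) ^ (-(1 : ℝ) / k)
  else 0

/-- The normalized Laplacian form `𝓛 x^k`. -/
noncomputable def normLapForm {n : ℕ} (E : Finset (Finset (Fin n))) (w : Finset (Fin n) → ℝ)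
    (k : ℕ) (x : Fin n → ℝ) : ℝ :=
  ∑ σ : Fin k → Fin n, normLapT E w k σ * ∏ t, x (σ t)

theorem card_injective_image_eq {α : Type*} [Fintype α] [DecidableEq α] {m : ℕ} {s : Finset α}
    (hs : s.card = m) :
    #{τ : Fin m → α | Function.Injective τ ∧ Finset.image τ univ = s} = m.factorial := by
  have hcard : Fintype.card (Fin m ↪ s) = m.factorial := by
    rw [Fintype.card_embedding_eq, Fintype.card_fin, Fintype.card_coe, hs, Nat.descFactorial_self]
  rw [← hcard, ← Finset.card_univ]
  symm
  refine Finset.card_bij (fun f _ t => (f t : α)) ?_ ?_ ?_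
  · intro f _
    have hinj : Function.Injective fun t => (f t : α) :=
      Subtype.val_injective.comp f.injective
    refine Finset.mem_filter.2 ⟨mem_univ _, hinj, ?_⟩
    refine Finset.eq_of_subset_of_card_le (fun a ha => ?_) ?_
    · obtain ⟨t, -, rfl⟩ := Finset.mem_image.1 ha
      exact (f t).2
    · rw [Finset.card_image_of_injective _ hinj, hs, Finset.card_univ, Fintype.card_fin]
  · intro f _ g _ h
    ext t
    exact congrFun h t
  · intro τ hτ
    obtain ⟨hinj, him⟩ := (Finset.mem_filter.1 hτ).2
    refine ⟨⟨fun t => ⟨τ t, him ▸ Finset.mem_image_of_mem τ (mem_univ t)⟩, ?_⟩, mem_univ _, rfl⟩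
    intro a b h
    exact hinj (congrArg Subtype.val h)

theorem consT_succ {n m : ℕ} (i : Fin n) (τ : Fin m → Fin n) :
    consT (m + 1) i τ = Fin.cons i τ := by
  funext t
  refine Fin.cases ?_ (fun t => ?_) t
  · simp [consT]
  · simp [consT]

theorem image_cons_univ {α : Type*} [DecidableEq α] {m : ℕ} (i : α) (τ : Fin m → α) :
    Finset.image (Fin.cons i τ : Fin (m + 1) → α) univ = insert i (Finset.image τ univ) := by
  ext a
  simp [Fin.exists_fin_succ, eq_comm]

theorem injective_cons_and_image_eq_iff {α : Type*} [DecidableEq α] {m : ℕ} {i : α}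
    {τ : Fin m → α} {e : Finset α} :
    (Function.Injective (Fin.cons i τ : Fin (m + 1) → α) ∧
        Finset.image (Fin.cons i τ : Fin (m + 1) → α) univ = e) ↔
      i ∈ e ∧ Function.Injective τ ∧ Finset.image τ univ = e.erase i := by
  rw [Fin.cons_injective_iff, image_cons_univ]
  constructor
  · rintro ⟨⟨hi, hinj⟩, rfl⟩
    refine ⟨mem_insert_self _ _, hinj, ?_⟩
    rw [erase_insert]
    simpa using hi
  · rintro ⟨hi, hinj, him⟩
    refine ⟨⟨fun h => ?_, hinj⟩, ?_⟩
    · have : i ∈ Finset.image τ univ := by simpa using h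
      rw [him] at this
      exact notMem_erase i e this
    · rw [him, insert_erase hi]

theorem sum_adjT_cons {n m : ℕ} {E : Finset (Finset (Fin n))} (w : Finset (Fin n) → ℝ)
    (hcard : ∀ e ∈ E, e.card = m + 1) (i : Fin n) :
    ∑ τ : Fin m → Fin n, adjT E w (m + 1) (Fin.cons i τ) = deg E w i := by
  have hexpand (τ : Fin m → Fin n) : adjT E w (m + 1) (Fin.cons i τ) =
      ∑ e ∈ E, if i ∈ e ∧ Function.Injective τ ∧ Finset.image τ univ = e.erase i
        then w e / m.factorial else 0 := by
    simp_rw [← injective_cons_and_image_eq_iff, ite_and]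
    by_cases hinj : Function.Injective (Fin.cons i τ : Fin (m + 1) → Fin n)
    · simp [adjT, hinj]
    · simp [adjT, hinj]
  simp_rw [hexpand]
  rw [Finset.sum_comm, deg, Finset.sum_filter]
  refine Finset.sum_congr rfl fun e he => ?_
  by_cases hi : i ∈ e
  · have hm : (e.erase i).card = m := by rw [card_erase_of_mem hi, hcard e he]; rfl
    have hfac : (m.factorial : ℝ) ≠ 0 := by positivity
    simp only [hi, true_and, if_true]
    rw [← Finset.sum_filter, Finset.sum_const, card_injective_image_eq hm, nsmul_eq_mul]
    field_simp
  · simp [hi]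

theorem cons_eq_const_iff {α : Type*} {m : ℕ} {i : α} {τ : Fin m → α} :
    (∃ j, (Fin.cons i τ : Fin (m + 1) → α) = Function.const (Fin (m + 1)) j) ↔
      τ = Function.const (Fin m) i := by
  constructor
  · rintro ⟨j, h⟩
    have h0 : i = j := congrFun h 0
    funext t
    rw [h0]
    exact congrFun h t.succ
  · rintro rfl
    refine ⟨i, funext fun t => ?_⟩
    refine Fin.cases rfl (fun t => rfl) t

theorem normLapT_cons_mul_prod {n m : ℕ} (hm : 1 ≤ m) {E : Finset (Finset (Fin n))}
    {w : Finset (Fin n) → ℝ} (hd : ∀ i, 0 < deg E w i) {x : Fin n → ℝ}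
    (hx : ∀ i, x i = (deg E w i) ^ ((1 : ℝ) / (m + 1 : ℕ))) (i : Fin n) (τ : Fin m → Fin n) :
    normLapT E w (m + 1) (Fin.cons i τ) * ∏ t, x (τ t) =
      (if τ = Function.const (Fin m) i then x i ^ m else 0) -
        (x i)⁻¹ * adjT E w (m + 1) (Fin.cons i τ) := by
  have hinv (j : Fin n) : deg E w j ^ (-(1 : ℝ) / (m + 1 : ℕ)) = (x j)⁻¹ := by
    rw [hx, neg_div, Real.rpow_neg (hd j).le]
  have hpos (j : Fin n) : 0 < x j := hx j ▸ Real.rpow_pos_of_pos (hd j) _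
  rw [normLapT, adjT]
  simp only [cons_eq_const_iff, hinv]
  by_cases hτ : τ = Function.const (Fin m) i
  · have hninj : ¬ Function.Injective (Fin.cons i τ : Fin (m + 1) → Fin n) := by
      rw [Fin.cons_injective_iff]
      rintro ⟨h, -⟩
      exact h ⟨⟨0, hm⟩, by rw [hτ]; rfl⟩
    rw [if_pos hτ, if_pos hτ, if_neg fun h => hninj h.1]
    simp [hτ]
  · rw [if_neg hτ, if_neg hτ]
    split_ifs
    · have hprod : (∏ t, x (τ t)) ≠ 0 := (Finset.prod_pos fun t _ => hpos (τ t)).ne'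
      rw [Fin.prod_univ_succ]
      simp only [Fin.cons_zero, Fin.cons_succ, Finset.prod_inv_distrib]
      field_simp
      simp
    · simp

theorem sum_normLapT_cons_mul_prod {n m : ℕ} (hm : 1 ≤ m) {E : Finset (Finset (Fin n))}
    {w : Finset (Fin n) → ℝ} (hcard : ∀ e ∈ E, e.card = m + 1) (hd : ∀ i, 0 < deg E w i)
    {x : Fin n → ℝ} (hx : ∀ i, x i = (deg E w i) ^ ((1 : ℝ) / (m + 1 : ℕ))) (i : Fin n) :
    ∑ τ : Fin m → Fin n, normLapT E w (m + 1) (Fin.cons i τ) * ∏ t, x (τ t) = 0 := by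
  have hpos : 0 < x i := hx i ▸ Real.rpow_pos_of_pos (hd i) _
  have hpow : deg E w i = x i ^ (m + 1) := by
    rw [hx, one_div, Real.rpow_inv_natCast_pow (hd i).le m.succ_ne_zero]
  simp_rw [normLapT_cons_mul_prod hm hd hx]
  rw [Finset.sum_sub_distrib, ← Finset.mul_sum, sum_adjT_cons w hcard, hpow,
    Finset.sum_ite_eq' univ, if_pos (mem_univ _), pow_succ', inv_mul_cancel_left₀ hpos.ne',
    sub_self]

theorem normLapForm_eq_sum {n m : ℕ} (E : Finset (Finset (Fin n))) (w : Finset (Fin n) → ℝ)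
    (x : Fin n → ℝ) :
    normLapForm E w (m + 1) x = ∑ i, x i * ∑ τ : Fin m → Fin n,
      normLapT E w (m + 1) (Fin.cons i τ) * ∏ t, x (τ t) := by
  rw [normLapForm, ← (Fin.consEquiv fun _ : Fin (m + 1) => Fin n).sum_comp,
    Fintype.sum_prod_type]
  refine Finset.sum_congr rfl fun i _ => ?_
  rw [Finset.mul_sum]
  refine Finset.sum_congr rfl fun τ _ => ?_
  change normLapT E w (m + 1) (Fin.cons i τ) *
    ∏ t, x ((Fin.cons i τ : Fin (m + 1) → Fin n) t) = _
  simp only [Fin.prod_univ_succ, Fin.cons_zero, Fin.cons_succ]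
  ring

/-- the vector `x i = (d i)^(1/k)` is a zero Z-eigenvector of the normalized
Laplacian tensor. -/
theorem normLap_zero_eigenvector
    (n k : ℕ) (hn : 1 ≤ n) (hk : 2 ≤ k)
    (E : Finset (Finset (Fin n))) (w : Finset (Fin n) → ℝ)
    (hcard : ∀ e ∈ E, e.card = k) (hw : ∀ e ∈ E, 0 < w e)
    (hd : ∀ i, 0 < deg E w i)
    (x : Fin n → ℝ) (hx : ∀ i, x i = (deg E w i) ^ ((1 : ℝ) / k)) :
    (∀ i : Fin n,
      ∑ τ : Fin (k - 1) → Fin n, normLapT E w k (consT k i τ) * ∏ t, x (τ t) = 0) ∧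
    normLapForm E w k x = 0 := by
  obtain ⟨m, rfl⟩ : ∃ m, k = m + 1 := ⟨k - 1, by omega⟩
  have hsum := sum_normLapT_cons_mul_prod (by omega) hcard hd hx
  refine ⟨fun i => ?_, ?_⟩
  · simp_rw [← consT_succ] at hsum
    exact hsum i
  · simp [normLapForm_eq_sum, hsum]
end
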